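/- Let d = 2 and suppose q = (q̄, q_n(q̄)) is a normalized central configuration with y_{n−1} = 0. If x_{n−1} = x_n or x_{n−1} = 0, then q is a degenerate solution of the reduced system RS, i.e. the Jacobian matrix D RS at the corresponding point is singular (its rank is strictly less than 2n − 3). -/

import Mathlib

open scoped BigOperators

noncomputable section

/-- Points in `ℝ^d`, with the Euclidean norm. -/
abbrev Pt (d : ℕ) := EuclideanSpace ℝ (Fin d)

/-- `F_i(q) = −q_i + Σ_{j ≠ i} m_j (q_j − q_i)/‖q_j − q_i‖³`. -/
noncomputable def nbodyF {d n : ℕ} (m : Fin n → ℝ) (q : Fin n → Pt d) : Fin n → Pt d :=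
  fun i => -q i + ∑ j ∈ Finset.univ.erase i, (m j / ‖q j - q i‖ ^ 3) • (q j - q i)

/-- A configuration is collision-free if all bodies occupy distinct positions. -/
def CollisionFree {d n : ℕ} (q : Fin n → Pt d) : Prop :=
  ∀ i j, i ≠ j → q i ≠ q j

/-- A normalized central configuration: collision-free, center of mass at the origin,
and `F(q) = 0`. -/
def IsNCC {d n : ℕ} (m : Fin n → ℝ) (q : Fin n → Pt d) : Prop :=
  CollisionFree q ∧ (∑ i, m i • q i) = 0 ∧ nbodyF m q = 0

/-- Embedding of the reduced index set `{1,…,n−1}` into `{1,…,n}`. -/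
def emb {n : ℕ} (i : Fin (n - 1)) : Fin n := Fin.castLE (Nat.sub_le n 1) i

/-- Extend a reduced configuration `q̄ = (q_1,…,q_{n−1})` by the position of the last body,
`q_n(q̄) = −(1/m_n) Σ_{i<n} m_i q_i`, computed from the center of mass condition. -/
noncomputable def extendConfig {d n : ℕ} (m : Fin n → ℝ) (qbar : Fin (n - 1) → Pt d) :
    Fin n → Pt d :=
  fun i => if h : (i : ℕ) < n - 1 then qbar ⟨i, h⟩
    else (-(1 / m i)) • ∑ j : Fin (n - 1), m (emb j) • qbar j

/-- The center-of-mass reduced map `F^red_i(q̄) = F_i(q_1,…,q_{n−1},q_n(q̄))`, `i = 1,…,n−1`. -/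
noncomputable def Fred {d n : ℕ} (m : Fin n → ℝ) (qbar : Fin (n - 1) → Pt d) :
    Fin (n - 1) → Pt d :=
  fun i => nbodyF m (extendConfig m qbar) (emb i)

/-- The Jacobian matrix of `F`, rows and columns indexed by (body, coordinate). -/
noncomputable def jacF {d n : ℕ} (m : Fin n → ℝ) (q : Fin n → Pt d) :
    Matrix (Fin n × Fin d) (Fin n × Fin d) ℝ :=
  fun p p' =>
    fderiv ℝ (fun q' : Fin n → Pt d => nbodyF m q' p.1 p.2) q
      (Pi.single p'.1 (EuclideanSpace.single p'.2 (1 : ℝ)))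

/-- The Jacobian matrix of `F^red`, rows and columns indexed by (body, coordinate). -/
noncomputable def jacFred {d n : ℕ} (m : Fin n → ℝ) (qbar : Fin (n - 1) → Pt d) :
    Matrix (Fin (n - 1) × Fin d) (Fin (n - 1) × Fin d) ℝ :=
  fun p p' =>
    fderiv ℝ (fun q' : Fin (n - 1) → Pt d => Fred m q' p.1 p.2) qbar
      (Pi.single p'.1 (EuclideanSpace.single p'.2 (1 : ℝ)))

/-- The Jacobian matrix of the planar reduced system `RS`: it is obtained from `DF^red`
by removing the row corresponding to `F^red_{n−1,y}` and the column corresponding to the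
variable `y_{n−1}` (here `x = 0`, `y = 1`, and the body of paper-index `n−1` is `⟨n−2,_⟩`). -/
noncomputable def DRS2 {n : ℕ} (hn : 3 ≤ n) (m : Fin n → ℝ) (qbar : Fin (n - 1) → Pt 2) :
    Matrix {p : Fin (n - 1) × Fin 2 // p ≠ (⟨n - 2, by omega⟩, 1)}
      {p : Fin (n - 1) × Fin 2 // p ≠ (⟨n - 2, by omega⟩, 1)} ℝ :=
  (jacFred m qbar).submatrix Subtype.val Subtype.val

theorem Matrix.rank_lt_card_of_mulVec_eq_zero {ι K : Type*} [Fintype ι] [Field K]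
    {A : Matrix ι ι K} {v : ι → K} (hv : v ≠ 0) (h : A.mulVec v = 0) :
    A.rank < Fintype.card ι := by
  have hker : 0 < Module.finrank K (LinearMap.ker A.mulVecLin) :=
    Module.finrank_pos_iff_exists_ne_zero.2
      ⟨⟨v, by simpa using h⟩, fun h0 => hv (congrArg Subtype.val h0)⟩
  have hsum := LinearMap.finrank_range_add_finrank_ker A.mulVecLin
  rw [Module.finrank_fintype_fun_eq_card] at hsum
  unfold Matrix.rank
  omega

theorem Matrix.rank_lt_card_of_vecMul_eq_zero {ι K : Type*} [Fintype ι] [Field K]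
    {A : Matrix ι ι K} {v : ι → K} (hv : v ≠ 0) (h : A.vecMul v = 0) :
    A.rank < Fintype.card ι := by
  rw [← Matrix.rank_transpose]
  exact Matrix.rank_lt_card_of_mulVec_eq_zero hv (by rwa [Matrix.mulVec_transpose])

/-- The last index is the only one outside the range of `emb`. -/
theorem sum_eq_sum_emb_add_last {M : Type*} [AddCommMonoid M] {n : ℕ} (hn : 0 < n)
    (f : Fin n → M) :
    ∑ i, f i = ∑ i : Fin (n - 1), f (emb i) + f ⟨n - 1, by omega⟩ := by
  obtain ⟨k, rfl⟩ : ∃ k, n = k + 1 := ⟨n - 1, by omega⟩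
  exact Fin.sum_univ_castSucc f

theorem extendConfig_emb {d n : ℕ} (m : Fin n → ℝ) (qbar : Fin (n - 1) → Pt d)
    (i : Fin (n - 1)) : extendConfig m qbar (emb i) = qbar i := by
  simp [extendConfig, emb]

theorem extendConfig_last {d n : ℕ} (hn : 0 < n) (m : Fin n → ℝ) (qbar : Fin (n - 1) → Pt d) :
    extendConfig m qbar ⟨n - 1, by omega⟩ =
      (-(1 / m ⟨n - 1, by omega⟩)) • ∑ j : Fin (n - 1), m (emb j) • qbar j := by
  simp [extendConfig]

theorem sum_smul_extendConfig {d n : ℕ} (hn : 0 < n) {m : Fin n → ℝ} (hm : ∀ i, 0 < m i)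
    (qbar : Fin (n - 1) → Pt d) : ∑ i, m i • extendConfig m qbar i = 0 := by
  rw [sum_eq_sum_emb_add_last hn, extendConfig_last hn]
  have := (hm ⟨n - 1, by omega⟩).ne'
  simp [extendConfig_emb, smul_smul, this]

theorem nbodyF_apply {d n : ℕ} (m : Fin n → ℝ) (q : Fin n → Pt d) (i : Fin n) (a : Fin d) :
    nbodyF m q i a = -q i a + ∑ j, m j / ‖q j - q i‖ ^ 3 * (q j a - q i a) := by
  rw [← Finset.add_sum_erase _ _ (Finset.mem_univ i)]
  simp [nbodyF]

/-- A linear isometry commutes with the force map. -/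
theorem nbodyF_comp_linearIsometry {d n : ℕ} (m : Fin n → ℝ) (q : Fin n → Pt d)
    (R : Pt d →ₗᵢ[ℝ] Pt d) (i : Fin n) :
    nbodyF m (fun j => R (q j)) i = R (nbodyF m q i) := by
  simp only [nbodyF, map_add, map_neg, map_sum, map_smul, ← map_sub, R.norm_map]

theorem extendConfig_comp_linearIsometry {d n : ℕ} (m : Fin n → ℝ) (qbar : Fin (n - 1) → Pt d)
    (R : Pt d →ₗᵢ[ℝ] Pt d) :
    extendConfig m (fun j => R (qbar j)) = fun i => R (extendConfig m qbar i) := by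
  funext i
  unfold extendConfig
  split_ifs <;> simp

theorem Fred_comp_linearIsometry {d n : ℕ} (m : Fin n → ℝ) (qbar : Fin (n - 1) → Pt d)
    (R : Pt d →ₗᵢ[ℝ] Pt d) (i : Fin (n - 1)) :
    Fred m (fun j => R (qbar j)) i = R (Fred m qbar i) := by
  simp only [Fred, extendConfig_comp_linearIsometry, nbodyF_comp_linearIsometry]

theorem differentiable_extendConfig {d n : ℕ} (m : Fin n → ℝ) (i : Fin n) :
    Differentiable ℝ fun qbar : Fin (n - 1) → Pt d => extendConfig m qbar i := by
  unfold extendConfig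
  split_ifs <;> fun_prop

theorem differentiableAt_Fred {d n : ℕ} (m : Fin n → ℝ) {qbar : Fin (n - 1) → Pt d}
    (hq : CollisionFree (extendConfig m qbar)) (i : Fin (n - 1)) :
    DifferentiableAt ℝ (fun q' => Fred m q' i) qbar := by
  have he := fun j => (differentiable_extendConfig (d := d) m j).differentiableAt (x := qbar)
  unfold Fred nbodyF
  refine (he _).neg.add (DifferentiableAt.fun_sum fun j hj => ?_)
  have hne : extendConfig m qbar j - extendConfig m qbar (emb i) ≠ 0 :=
    sub_ne_zero.2 (hq _ _ (Finset.ne_of_mem_erase hj))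
  have hsub := (he j).sub (he (emb i))
  have hpow := (hsub.norm ℝ hne).fun_pow 3
  refine DifferentiableAt.fun_smul ?_ hsub
  simp only [div_eq_mul_inv]
  exact (hpow.fun_inv (pow_ne_zero _ (norm_ne_zero_iff.2 hne))).const_mul (m j)

theorem differentiableAt_Fred_apply {d n : ℕ} (m : Fin n → ℝ) {qbar : Fin (n - 1) → Pt d}
    (hq : CollisionFree (extendConfig m qbar)) (i : Fin (n - 1)) (a : Fin d) :
    DifferentiableAt ℝ (fun q' => Fred m q' i a) qbar :=
  (differentiableAt_euclidean.1 (differentiableAt_Fred m hq i)) a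

theorem jacFred_mulVec {d n : ℕ} (m : Fin n → ℝ) (qbar v : Fin (n - 1) → Pt d)
    (p : Fin (n - 1) × Fin d) :
    (jacFred m qbar).mulVec (fun p' => v p'.1 p'.2) p =
      fderiv ℝ (fun q' => Fred m q' p.1 p.2) qbar v := by
  have hv : v = ∑ p' : Fin (n - 1) × Fin d,
      v p'.1 p'.2 • Pi.single p'.1 (EuclideanSpace.single p'.2 (1 : ℝ)) := by
    ext i a
    simp [Fintype.sum_prod_type, Finset.sum_apply, Pi.single_apply, apply_ite]
  conv_rhs => rw [hv]
  simp [Matrix.mulVec, dotProduct, jacFred, mul_comm]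

/-- The planar quarter turn. -/
def quarterTurn : Pt 2 →ₗ[ℝ] Pt 2 where
  toFun v := !₂[-v 1, v 0]
  map_add' u v := by ext a; fin_cases a <;> simp [add_comm]
  map_smul' c v := by ext a; fin_cases a <;> simp

@[simp] theorem quarterTurn_apply_zero (v : Pt 2) : quarterTurn v 0 = -v 1 := rfl

@[simp] theorem quarterTurn_apply_one (v : Pt 2) : quarterTurn v 1 = v 0 := rfl

/-- The planar rotation by the angle `t`. -/
def planeRotation (t : ℝ) : Pt 2 →ₗᵢ[ℝ] Pt 2 where
  toLinearMap := Real.cos t • LinearMap.id + Real.sin t • quarterTurn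
  norm_map' v := by
    simp only [EuclideanSpace.norm_eq, Fin.sum_univ_two]
    congr 1
    simp
    linear_combination (v 0 ^ 2 + v 1 ^ 2) * Real.sin_sq_add_cos_sq t

theorem planeRotation_apply (t : ℝ) (v : Pt 2) :
    planeRotation t v = Real.cos t • v + Real.sin t • quarterTurn v := rfl

/-- Infinitesimal rotations of a central configuration lie in the kernel of the Jacobian. -/
theorem jacFred_mulVec_quarterTurn {n : ℕ} {m : Fin n → ℝ} {qbar : Fin (n - 1) → Pt 2}
    (hcc : IsNCC m (extendConfig m qbar)) :
    (jacFred m qbar).mulVec (fun p => quarterTurn (qbar p.1) p.2) = 0 := by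
  funext p
  rw [jacFred_mulVec m qbar fun i => quarterTurn (qbar i)]
  have hF : ∀ t, Fred m (fun j => planeRotation t (qbar j)) p.1 p.2 = 0 := fun t => by
    rw [Fred_comp_linearIsometry]
    simp [Fred, hcc.2.2]
  have hcurve : HasDerivAt (fun t j => planeRotation t (qbar j))
      (fun i => quarterTurn (qbar i)) 0 := by
    refine hasDerivAt_pi.2 fun i => ?_
    simpa [planeRotation_apply] using
      ((Real.hasDerivAt_cos 0).smul_const (qbar i)).fun_add
        ((Real.hasDerivAt_sin 0).smul_const (quarterTurn (qbar i)))
  have h0 : (fun j => planeRotation 0 (qbar j)) = qbar := by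
    simp [planeRotation_apply]
  have hd := (differentiableAt_Fred_apply m hcc.1 p.1 p.2).hasFDerivAt
  have := hd.comp_hasDerivAt_of_eq 0 hcurve h0.symm
  refine this.unique ?_
  simpa [Function.comp_def, hF] using hasDerivAt_const (0 : ℝ) (0 : ℝ)

theorem sum_sum_eq_zero_of_antisymm {ι : Type*} [Fintype ι] {f : ι → ι → ℝ}
    (h : ∀ i j, f i j = -f j i) : ∑ i, ∑ j, f i j = 0 := by
  have : ∑ i, ∑ j, f i j = -∑ i, ∑ j, f i j := by
    conv_lhs => rw [Finset.sum_comm]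
    simp only [← Finset.sum_neg_distrib]
    exact Finset.sum_congr rfl fun i _ => Finset.sum_congr rfl fun j _ => h _ _
  linarith

/-- The total torque about any point vanishes once the center of mass is at the origin. -/
theorem sum_torque_eq_zero {n : ℕ} {m : Fin n → ℝ} {q : Fin n → Pt 2}
    (hq : ∑ i, m i • q i = 0) (c : Pt 2) :
    ∑ i, (m i * quarterTurn (q i - c) 0 * nbodyF m q i 0 +
      m i * quarterTurn (q i - c) 1 * nbodyF m q i 1) = 0 := by
  have hcoord : ∀ a, ∑ i, m i * q i a = 0 := fun a => by
    simpa using congrArg (fun v : Pt 2 => v a) hq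
  have hanti : ∑ i, ∑ j, m i * m j / ‖q j - q i‖ ^ 3 *
      ((q i 0 - c 0) * (q j 1 - q i 1) - (q i 1 - c 1) * (q j 0 - q i 0)) = 0 :=
    sum_sum_eq_zero_of_antisymm fun i j => by
      rw [norm_sub_rev (q j) (q i)]
      ring
  have hterm : ∀ i, m i * quarterTurn (q i - c) 0 * nbodyF m q i 0 +
      m i * quarterTurn (q i - c) 1 * nbodyF m q i 1 =
      c 0 * (m i * q i 1) - c 1 * (m i * q i 0) + ∑ j, m i * m j / ‖q j - q i‖ ^ 3 *
        ((q i 0 - c 0) * (q j 1 - q i 1) - (q i 1 - c 1) * (q j 0 - q i 0)) := fun i => by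
    have hsplit : ∑ j, m i * m j / ‖q j - q i‖ ^ 3 *
        ((q i 0 - c 0) * (q j 1 - q i 1) - (q i 1 - c 1) * (q j 0 - q i 0)) =
        m i * (q i 0 - c 0) * ∑ j, m j / ‖q j - q i‖ ^ 3 * (q j 1 - q i 1) -
        m i * (q i 1 - c 1) * ∑ j, m j / ‖q j - q i‖ ^ 3 * (q j 0 - q i 0) := by
      rw [Finset.mul_sum, Finset.mul_sum, ← Finset.sum_sub_distrib]
      exact Finset.sum_congr rfl fun j _ => by ring
    rw [hsplit, nbodyF_apply, nbodyF_apply]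
    simp
    ring
  rw [Finset.sum_congr rfl fun i _ => hterm i, Finset.sum_add_distrib, hanti,
    Finset.sum_sub_distrib, ← Finset.mul_sum, ← Finset.mul_sum, hcoord, hcoord]
  ring

/-- The torque identity expressed through the reduced map. -/
theorem sum_torque_Fred_eq_zero {n : ℕ} (hn : 0 < n) {m : Fin n → ℝ} (hm : ∀ i, 0 < m i)
    (qbar : Fin (n - 1) → Pt 2) :
    ∑ p : Fin (n - 1) × Fin 2, m (emb p.1) *
      quarterTurn (qbar p.1 - extendConfig m qbar ⟨n - 1, by omega⟩) p.2 *
        Fred m qbar p.1 p.2 = 0 := by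
  have h := sum_torque_eq_zero (sum_smul_extendConfig hn hm qbar)
    (extendConfig m qbar ⟨n - 1, by omega⟩)
  rw [sum_eq_sum_emb_add_last hn] at h
  simpa [Fintype.sum_prod_type, extendConfig_emb, Fred] using h

/-- Differentiating the torque identity at a central configuration gives a vector in the left
kernel of the Jacobian. -/
theorem vecMul_jacFred_torque {n : ℕ} (hn : 0 < n) {m : Fin n → ℝ} (hm : ∀ i, 0 < m i)
    {qbar : Fin (n - 1) → Pt 2} (hcc : IsNCC m (extendConfig m qbar)) :
    (jacFred m qbar).vecMul (fun p => m (emb p.1) *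
      quarterTurn (qbar p.1 - extendConfig m qbar ⟨n - 1, by omega⟩) p.2) = 0 := by
  set w : (Fin (n - 1) → Pt 2) → Fin (n - 1) × Fin 2 → ℝ := fun q' p => m (emb p.1) *
    quarterTurn (q' p.1 - extendConfig m q' ⟨n - 1, by omega⟩) p.2 with hw
  have hwd : ∀ p, DifferentiableAt ℝ (fun q' => w q' p) qbar := fun p => by
    have he := (differentiable_extendConfig (d := 2) m ⟨n - 1, by omega⟩).differentiableAt
      (x := qbar)
    have hsub : DifferentiableAt ℝ (fun q' : Fin (n - 1) → Pt 2 =>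
        quarterTurn (q' p.1 - extendConfig m q' ⟨n - 1, by omega⟩)) qbar :=
      quarterTurn.toContinuousLinearMap.differentiableAt.comp qbar
        (DifferentiableAt.sub (by fun_prop) he)
    exact (differentiableAt_euclidean.1 hsub p.2).const_mul _
  have hprod : ∀ p : Fin (n - 1) × Fin 2, HasFDerivAt (fun q' => w q' p * Fred m q' p.1 p.2)
      (w qbar p • fderiv ℝ (fun q' => Fred m q' p.1 p.2) qbar) qbar := fun p => by
    have h0 : Fred m qbar p.1 p.2 = 0 := by simp [Fred, hcc.2.2]
    simpa [h0] using (hwd p).hasFDerivAt.fun_mul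
      (differentiableAt_Fred_apply m hcc.1 p.1 p.2).hasFDerivAt
  have hsum := HasFDerivAt.fun_sum fun p (_ : p ∈ Finset.univ) => hprod p
  have hzero : (fun q' => ∑ p, w q' p * Fred m q' p.1 p.2) = fun _ => 0 :=
    funext fun q' => sum_torque_Fred_eq_zero hn hm q'
  rw [hzero] at hsum
  have heq := hsum.unique (hasFDerivAt_const (0 : ℝ) qbar)
  funext p'
  simpa [Matrix.vecMul, dotProduct, jacFred, hw] using
    congrArg (fun L => L (Pi.single p'.1 (EuclideanSpace.single p'.2 (1 : ℝ)))) heq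

/-- A sum over all indices but one, when the remaining term vanishes. -/
theorem Fintype.sum_subtype_ne_of_eq_zero {ι M : Type*} [Fintype ι] [DecidableEq ι]
    [AddCommMonoid M] {f : ι → M} {b : ι} (hb : f b = 0) :
    ∑ p : {p : ι // p ≠ b}, f p = ∑ p, f p := by
  rw [Fintype.sum_eq_add_sum_subtype_ne f b, hb, zero_add]

theorem Matrix.rank_submatrix_ne_lt_of_mulVec_eq_zero {ι K : Type*} [Fintype ι] [DecidableEq ι]
    [Field K] {A : Matrix ι ι K} {v : ι → K} {b : ι} (hv : v ≠ 0) (hb : v b = 0)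
    (h : A.mulVec v = 0) :
    (A.submatrix (Subtype.val : {p // p ≠ b} → ι) (Subtype.val : {p // p ≠ b} → ι)).rank <
      Fintype.card ι - 1 := by
  obtain ⟨p, hp⟩ := Function.ne_iff.1 hv
  have hpb : p ≠ b := by rintro rfl; exact hp hb
  rw [← Set.card_ne_eq b]
  refine Matrix.rank_lt_card_of_mulVec_eq_zero (v := fun p => v p)
    (fun h0 => hp (congrFun h0 ⟨p, hpb⟩)) ?_
  funext i
  have := Fintype.sum_subtype_ne_of_eq_zero (f := fun p => A i p * v p) (b := b) (by simp [hb])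
  exact this.trans (congrFun h i)

theorem Matrix.rank_submatrix_ne_lt_of_vecMul_eq_zero {ι K : Type*} [Fintype ι] [DecidableEq ι]
    [Field K] {A : Matrix ι ι K} {v : ι → K} {b : ι} (hv : v ≠ 0) (hb : v b = 0)
    (h : A.vecMul v = 0) :
    (A.submatrix (Subtype.val : {p // p ≠ b} → ι) (Subtype.val : {p // p ≠ b} → ι)).rank <
      Fintype.card ι - 1 := by
  rw [← Matrix.rank_transpose, Matrix.transpose_submatrix]
  exact Matrix.rank_submatrix_ne_lt_of_mulVec_eq_zero hv hb (by rwa [Matrix.mulVec_transpose])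

/-- for a planar nCC with `y_{n−1} = 0`, if `x_{n−1} = x_n` or `x_{n−1} = 0`,
then `D RS` is singular, i.e. its rank is `< 2n − 3`. -/
theorem stmt9 {n : ℕ} (hn : 3 ≤ n) (m : Fin n → ℝ) (hm : ∀ i, 0 < m i)
    (qbar : Fin (n - 1) → Pt 2) (hcc : IsNCC m (extendConfig m qbar))
    (hy : qbar ⟨n - 2, by omega⟩ 1 = 0)
    (hx : qbar ⟨n - 2, by omega⟩ 0 = extendConfig m qbar ⟨n - 1, by omega⟩ 0 ∨
      qbar ⟨n - 2, by omega⟩ 0 = 0) :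
    (DRS2 hn m qbar).rank < 2 * n - 3 := by
  have hcard : 2 * n - 3 = Fintype.card (Fin (n - 1) × Fin 2) - 1 := by
    simp only [Fintype.card_prod, Fintype.card_fin]
    omega
  rw [hcard]
  have hne : ∀ i : Fin (n - 1), ∀ j : Fin n, emb i ≠ j →
      qbar i ≠ extendConfig m qbar j := fun i j hij => by
    simpa [extendConfig_emb] using hcc.1 (emb i) j hij
  rcases hx with hx | hx
  · refine Matrix.rank_submatrix_ne_lt_of_vecMul_eq_zero (fun h0 => ?_) ?_
      (vecMul_jacFred_torque (by omega) hm hcc)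
    · refine hne ⟨n - 2, by omega⟩ ⟨n - 1, by omega⟩ (by simp [emb, Fin.ext_iff]; omega) ?_
      ext a
      fin_cases a
      · exact hx
      · have := congrFun h0 (⟨n - 2, by omega⟩, 0)
        simp [(hm _).ne'] at this
        simp
        linarith
    · simp [hx]
  · refine Matrix.rank_submatrix_ne_lt_of_mulVec_eq_zero (fun h0 => ?_) ?_
      (jacFred_mulVec_quarterTurn hcc)
    · refine hne ⟨n - 2, by omega⟩ (emb ⟨0, by omega⟩)
        (by simp [emb, Fin.ext_iff]; omega) ?_
      rw [extendConfig_emb]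
      ext a
      have h1 := congrFun h0 (⟨0, by omega⟩, 0)
      have h2 := congrFun h0 (⟨0, by omega⟩, 1)
      fin_cases a
      · simpa [hx] using h2.symm
      · simp at h1
        simp [hy, h1]
    · simpa using hx
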